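/- Let X be a nonempty set, n ≥ 3, let F : X^n → X be associative, and let e_1, e_2 ∈ E_F be neutral elements for F. Define binary operations G_{e_1}, G_{e_2} : X^2 → X by G_{e_i}(x,y) = F(x, (n-2)·e_i, y). Then the semigroups (X, G_{e_1}) and (X, G_{e_2}) are isomorphic; in fact the map ψ : X → X defined by ψ(x) = F(e_1, e_2, x, (n-3)·e_1) is a bijection satisfying ψ(G_{e_1}(x,y)) = G_{e_2}(ψ(x), ψ(y)) for all x, y ∈ X. -/

import Mathlib

variable {X : Type*}

/-- The result of substituting `F` applied to the `n` consecutive entries starting at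
position `i` of the `(2n-1)`-tuple `x` (given as the first `2n-1` values of `x : ℕ → X`),
and then applying `F` to the resulting `n`-tuple. -/
def naryCompAt (n : ℕ) (F : (Fin n → X) → X) (x : ℕ → X) (i : ℕ) : X :=
  F fun j => if (j : ℕ) < i then x j
    else if (j : ℕ) = i then F (fun k => x (i + (k : ℕ)))
    else x ((j : ℕ) + n - 1)

/-- `F` is an associative `n`-ary operation. -/
def NAryAssociative (n : ℕ) (F : (Fin n → X) → X) : Prop :=
  ∀ (x : ℕ → X) (i : ℕ), i + 1 ≤ n - 1 → naryCompAt n F x i = naryCompAt n F x (i + 1)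

/-- `e` is a neutral element for the `n`-ary operation `F`: inserting the argument `a` at
any position `p`, with `e` at all the other positions, returns `a`. -/
def NAryNeutral (n : ℕ) (F : (Fin n → X) → X) (e : X) : Prop :=
  ∀ (a : X) (p : Fin n), F (Function.update (fun _ => e) p a) = a

/-- The set `E_F` of neutral elements for `F`. -/
def naryNeutralSet (n : ℕ) (F : (Fin n → X) → X) : Set X :=
  {e | NAryNeutral n F e}

/-- `e` is a neutral element for the restriction of `F` to `S^n`. -/
def NAryNeutralOn (n : ℕ) (F : (Fin n → X) → X) (S : Set X) (e : X) : Prop :=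
  e ∈ S ∧ ∀ a ∈ S, ∀ p : Fin n, F (Function.update (fun _ => e) p a) = a

/-- `iterOp G m x = G (x 0) (G (x 1) (⋯ (G (x (m-1)) (x m))⋯))`,
the `m`-fold iterate of the binary operation `G`, applied to `m+1` arguments. -/
def iterOp (G : X → X → X) : ℕ → (ℕ → X) → X
  | 0, x => x 0
  | m + 1, x => G (x 0) (iterOp G m fun i => x (i + 1))

/-- The `n`-ary operation `F` is reducible to the binary operation `G`, i.e. `F` is the
`(n-1)`-fold iterate of `G`. -/
def NAryReducibleTo (n : ℕ) (F : (Fin n → X) → X) (G : X → X → X) : Prop :=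
  ∀ x : ℕ → X, F (fun i : Fin n => x i) = iterOp G (n - 1) x

/-- `gPow G a m` is the `G`-product of `m + 1` copies of `a`. -/
def gPow (G : X → X → X) (a : X) : ℕ → X
  | 0 => a
  | m + 1 => G a (gPow G a m)

/-- `(Y, G)` is an Abelian group whose exponent divides `m` (for `m ≥ 1`): `G` maps `Y × Y`
into `Y` and is commutative and associative on `Y`, and `Y` contains a neutral element `e`
for which every element of `Y` has an inverse and such that the `G`-product of `m` copies of
any element of `Y` equals `e`. -/
def IsAbelianGroupOfExpDvdOn (Y : Set X) (G : X → X → X) (m : ℕ) : Prop :=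
  (∀ a ∈ Y, ∀ b ∈ Y, G a b ∈ Y) ∧
  (∀ a ∈ Y, ∀ b ∈ Y, G a b = G b a) ∧
  (∀ a ∈ Y, ∀ b ∈ Y, ∀ c ∈ Y, G (G a b) c = G a (G b c)) ∧
  ∃ e ∈ Y, (∀ a ∈ Y, G e a = a) ∧ (∀ a ∈ Y, ∃ b ∈ Y, G a b = e) ∧
    (∀ a ∈ Y, gPow G a (m - 1) = e)

/-- The tuple `x` lies in `D^n_k`: at least `k` of its components are equal to each other. -/
def MemD (n k : ℕ) (x : Fin n → X) : Prop :=
  ∃ S : Finset (Fin n), k ≤ S.card ∧ ∀ i ∈ S, ∀ j ∈ S, x i = x j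

/-- `F` is quasitrivial on `D^n_k`. -/
def NAryQuasitrivialOnD (n k : ℕ) (F : (Fin n → X) → X) : Prop :=
  ∀ x : Fin n → X, MemD n k x → F x ∈ Set.range x

/-- `F` is quasitrivial on `S^n_k`, the set of tuples taking at most `k` distinct values. -/
def NAryQuasitrivialOnS (n k : ℕ) (F : (Fin n → X) → X) : Prop :=
  ∀ x : Fin n → X, (Set.range x).encard ≤ k → F x ∈ Set.range x

/-- `F` is quasitrivial. -/
def NAryQuasitrivial (n : ℕ) (F : (Fin n → X) → X) : Prop :=
  ∀ x : Fin n → X, F x ∈ Set.range x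

theorem NAryAssociative.naryCompAt_eq_zero {n : ℕ} {F : (Fin n → X) → X}
    (hF : NAryAssociative n F) (x : ℕ → X) :
    ∀ i ≤ n - 1, naryCompAt n F x i = naryCompAt n F x 0
  | 0, _ => rfl
  | i + 1, h => (hF x i h).symm.trans (hF.naryCompAt_eq_zero x i (by omega))

/-- The value of `naryCompAt` once the inner value `a` and the outer tuple `f` are identified. -/
theorem naryCompAt_eq {n : ℕ} {F : (Fin n → X) → X} {x : ℕ → X} {i : ℕ} {f g : Fin n → X}
    (hg : ∀ k : Fin n, x (i + k) = g k)
    (hf : ∀ j : Fin n, (if (j : ℕ) < i then x j else if (j : ℕ) = i then F g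
      else x ((j : ℕ) + n - 1)) = f j) :
    naryCompAt n F x i = F f := by
  have h : (fun k : Fin n => x (i + k)) = g := funext hg
  unfold naryCompAt
  rw [h]
  exact congrArg F (funext hf)

theorem NAryNeutral.apply_eq {n : ℕ} {F : (Fin n → X) → X} {e : X} (he : NAryNeutral n F e)
    {p : ℕ} (hp : p < n) (a : X) {f : Fin n → X}
    (hf : ∀ j : Fin n, f j = if (j : ℕ) = p then a else e) : F f = a := by
  rw [← he a ⟨p, hp⟩]
  congr 1
  funext j
  rw [hf j, Function.update_apply]
  simp [Fin.ext_iff]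

/-- The binary operation `(x, y) ↦ F (x, (n-2)·e, y)`. -/
def naryReduct (n : ℕ) (F : (Fin n → X) → X) (e x y : X) : X :=
  F fun j => if (j : ℕ) = 0 then x else if (j : ℕ) = n - 1 then y else e

section Reduct

variable {n : ℕ} {F : (Fin n → X) → X} {e : X}

theorem naryReduct_neutral_left (hn : 2 ≤ n) (he : NAryNeutral n F e) (a : X) :
    naryReduct n F e e a = a :=
  he.apply_eq (p := n - 1) (by omega) a fun j => by grind

theorem naryReduct_neutral_right (hn : 2 ≤ n) (he : NAryNeutral n F e) (a : X) :
    naryReduct n F e a e = a :=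
  he.apply_eq (p := 0) (by omega) a fun j => by grind

theorem naryReduct_assoc (hn : 2 ≤ n) (hF : NAryAssociative n F) (a b c : X) :
    naryReduct n F e (naryReduct n F e a b) c = naryReduct n F e a (naryReduct n F e b c) := by
  have h := hF.naryCompAt_eq_zero
    (fun k => if k = 0 then a else if k = n - 1 then b else if k = 2 * n - 2 then c else e)
    (n - 1) le_rfl
  rw [naryCompAt_eq
      (g := fun j => if (j : ℕ) = 0 then b else if (j : ℕ) = n - 1 then c else e)
      (f := fun j => if (j : ℕ) = 0 then a else if (j : ℕ) = n - 1 then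
        naryReduct n F e b c else e) (by grind) (by grind [naryReduct]),
    naryCompAt_eq
      (g := fun j => if (j : ℕ) = 0 then a else if (j : ℕ) = n - 1 then b else e)
      (f := fun j => if (j : ℕ) = 0 then naryReduct n F e a b else if (j : ℕ) = n - 1 then
        c else e) (by grind) (by grind [naryReduct])] at h
  exact h.symm

/-- A trailing neutral element can be moved to the front. -/
theorem NAryAssociative.apply_shift (hn : 2 ≤ n) (hF : NAryAssociative n F)
    (he : NAryNeutral n F e) (x : ℕ → X) (hx : x (n - 1) = e) :
    F (fun j => x j) = F fun j => if (j : ℕ) = 0 then e else x ((j : ℕ) - 1) := by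
  have h := (hF.naryCompAt_eq_zero
    (fun k => if k < n - 1 then e else x (k - (n - 1))) (n - 2) (by omega))
  have h₁ : F (fun j => if (j : ℕ) = n - 1 then x 0 else e) = x 0 :=
    he.apply_eq (p := n - 1) (by omega) _ fun j => rfl
  rw [naryCompAt_eq
      (g := fun j => if (j : ℕ) = 0 then e else x ((j : ℕ) - 1))
      (f := fun j => if (j : ℕ) = n - 2 then
        F (fun j => if (j : ℕ) = 0 then e else x ((j : ℕ) - 1)) else e)
      (by grind) (by grind),
    naryCompAt_eq
      (g := fun j => if (j : ℕ) = n - 1 then x 0 else e)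
      (f := fun j => x j) (by grind) (by grind),
    he.apply_eq (p := n - 2) (by omega) _ fun j => rfl] at h
  exact h.symm

theorem naryReduct_apply (hn : 2 ≤ n) (hF : NAryAssociative n F) (he : NAryNeutral n F e)
    (a : X) (x : ℕ → X) (hx : x (n - 1) = e) :
    naryReduct n F e a (F fun j => x j) =
      F fun j => if (j : ℕ) = 0 then a else x ((j : ℕ) - 1) := by
  rw [hF.apply_shift hn he x hx]
  have h := hF.naryCompAt_eq_zero
    (fun k => if k = 0 then a else if k < n then e else x (k - n)) (n - 1) le_rfl
  have h₁ : F (fun j => if (j : ℕ) = 0 then a else e) = a :=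
    he.apply_eq (p := 0) (by omega) _ fun j => rfl
  rw [naryCompAt_eq
      (g := fun j => if (j : ℕ) = 0 then e else x ((j : ℕ) - 1))
      (f := fun j => if (j : ℕ) = 0 then a else if (j : ℕ) = n - 1 then
        F (fun j => if (j : ℕ) = 0 then e else x ((j : ℕ) - 1)) else e)
      (by grind) (by grind),
    naryCompAt_eq
      (g := fun j => if (j : ℕ) = 0 then a else e)
      (f := fun j => if (j : ℕ) = 0 then a else x ((j : ℕ) - 1)) (by grind) (by grind)] at h
  exact h

/-- The binary reduct of an associative operation at a neutral element is a monoid. -/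
abbrev naryReductMonoid (hn : 2 ≤ n) (hF : NAryAssociative n F) (he : NAryNeutral n F e) :
    Monoid X where
  mul := naryReduct n F e
  one := e
  mul_assoc := naryReduct_assoc hn hF
  one_mul := naryReduct_neutral_left hn he
  mul_one := naryReduct_neutral_right hn he

/-- `F` is the `n`-fold product of its binary reduct at a neutral element. -/
theorem apply_eq_prod (hn : 2 ≤ n) (hF : NAryAssociative n F) (he : NAryNeutral n F e)
    (l : List X) (hl : l.length ≤ n) (f : Fin n → X)
    (hf : ∀ j : Fin n, f j = l.getD j e) :
    letI := naryReductMonoid hn hF he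
    F f = l.prod := by
  let := naryReductMonoid hn hF he
  change F f = l.prod
  obtain rfl : f = fun j : Fin n => l.getD j e := funext hf
  clear hf
  induction l with
  | nil =>
    exact he.apply_eq (p := 0) (by omega) e fun j => by simp
  | cons a l ih =>
    rw [List.prod_cons, ← ih (by grind)]
    refine Eq.trans ?_ (naryReduct_apply hn hF he a (fun j => l.getD j e) (by grind)).symm
    congr 1
    funext j
    rcases j with ⟨_ | j, hj⟩ <;> simp

end Reduct

/-- The binary reductions `G_{e₁}`, `G_{e₂}` of an associative `F` obtained from two neutral
elements `e₁, e₂` yield isomorphic semigroups, via `ψ x = F (e₁, e₂, x, (n-3)·e₁)`. -/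
theorem stmt_3 {X : Type*} [Nonempty X] (n : ℕ) (hn : 3 ≤ n)
    (F : (Fin n → X) → X) (hF : NAryAssociative n F)
    (e₁ e₂ : X) (he₁ : NAryNeutral n F e₁) (he₂ : NAryNeutral n F e₂)
    (G₁ G₂ : X → X → X)
    (hG₁ : ∀ x y, G₁ x y =
      F (Function.update (Function.update (fun _ => e₁) (⟨0, by omega⟩ : Fin n) x)
          (⟨n - 1, by omega⟩ : Fin n) y))
    (hG₂ : ∀ x y, G₂ x y =
      F (Function.update (Function.update (fun _ => e₂) (⟨0, by omega⟩ : Fin n) x)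
          (⟨n - 1, by omega⟩ : Fin n) y))
    (ψ : X → X)
    (hψ : ∀ x, ψ x =
      F (fun j : Fin n => if (j : ℕ) = 1 then e₂ else if (j : ℕ) = 2 then x else e₁)) :
    Function.Bijective ψ ∧ ∀ x y, ψ (G₁ x y) = G₂ (ψ x) (ψ y) := by
  have hn' : 2 ≤ n := by omega
  let := naryReductMonoid hn' hF he₁
  have hprod : ∀ (l : List X), l.length ≤ n → ∀ f : Fin n → X,
      (∀ j : Fin n, f j = l.getD j e₁) → F f = l.prod := apply_eq_prod hn' hF he₁
  have hone : (1 : X) = e₁ := rfl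
  have hmul : ∀ x y, G₁ x y = x * y := fun x y => by
    refine (hG₁ x y).trans (congrArg F ?_)
    funext j
    simp only [Function.update_apply, Fin.ext_iff]
    grind
  have hψ' : ∀ x, ψ x = e₂ * x := fun x => by
    rw [hψ, hprod [e₁, e₂, x] (by simpa using hn)]
    · simp [← hone]
    · rintro ⟨_ | _ | _ | j, hj⟩ <;> simp
  have hG₂' : ∀ x y, G₂ x y = x * (e₂ ^ (n - 2) * y) := fun x y => by
    rw [hG₂, hprod (x :: (List.replicate (n - 2) e₂ ++ [y])) (by grind)]
    · simp
    · intro j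
      simp only [Function.update_apply, Fin.ext_iff]
      grind
  have hleft : ∀ a, a * e₂ ^ (n - 1) = a := fun a => by
    conv_rhs => rw [← he₂ a ⟨0, by omega⟩]
    rw [hprod (a :: List.replicate (n - 1) e₂) (by grind)]
    · simp
    · intro j
      simp only [Function.update_apply, Fin.ext_iff]
      grind
  have hmid : ∀ a, e₂ * (a * e₂ ^ (n - 2)) = a := fun a => by
    conv_rhs => rw [← he₂ a ⟨1, by omega⟩]
    rw [hprod (e₂ :: a :: List.replicate (n - 2) e₂) (by grind)]
    · simp
    · intro j
      simp only [Function.update_apply, Fin.ext_iff]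
      grind
  have hpow : e₂ ^ (n - 1) = 1 := by simpa using hleft 1
  have hpow₁ : e₂ * e₂ ^ (n - 2) = 1 := by simpa using hmid 1
  have hpow₂ : e₂ ^ (n - 2) * e₂ = 1 := by rw [← pow_succ, ← hpow]; congr 1; omega
  have hcomm : ∀ a, e₂ * a = a * e₂ := fun a => by
    conv_rhs => rw [← hmid a]
    simp only [mul_assoc, hpow₂, mul_one]
  refine ⟨Function.bijective_iff_has_inverse.2 ⟨fun x => e₂ ^ (n - 2) * x, fun x => ?_,
    fun x => ?_⟩, fun x y => ?_⟩
  · simp only [hψ', ← mul_assoc, hpow₂, one_mul]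
  · simp only [hψ', ← mul_assoc, hpow₁, one_mul]
  · rw [hψ', hψ', hψ', hmul, hG₂', ← mul_assoc (e₂ ^ (n - 2)), hpow₂, one_mul, mul_assoc]
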